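/- Let $p$ be a prime and $n \ge 9$ with $p \le n - 3$. Then $p$ divides the index $[A_n : H]$ of every primitive proper subgroup $H < A_n$. -/

import Mathlib

section aux
open MulAction Equiv Equiv.Perm

theorem conj_into {Γ : Type*} [Group Γ] [Finite Γ] {p : ℕ} [Fact p.Prime] (P H : Subgroup Γ)
    (hP : IsPGroup p P) (hH : ¬ p ∣ H.index) : ∃ x : Γ, ∀ k ∈ P, x⁻¹ * k * x ∈ H := by
  obtain ⟨q, hq⟩ := hP.nonempty_fixed_point_of_prime_not_dvd_card (Γ ⧸ H) hH
  induction q using QuotientGroup.induction_on with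
  | H x =>
    refine ⟨x, fun k hk => ?_⟩
    have h1 : ((k * x : Γ) : Γ ⧸ H) = (x : Γ ⧸ H) := hq ⟨k, hk⟩
    have h2 := QuotientGroup.eq.1 h1.symm
    rwa [← mul_assoc] at h2

theorem fix_card {α : Type*} [Fintype α] [DecidableEq α] (S : Finset α) (K : Subgroup (Perm α))
    (hK : ∀ f ∈ K, ∀ x ∉ S, f x = x) : Nat.card K ∣ (S.card).factorial := by
  have hm : ∀ f ∈ K, ∀ x, f x ∈ S ↔ x ∈ S := by
    intro f hf x
    by_cases hx : x ∈ S
    · simp only [hx, iff_true]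
      by_contra h
      have := hK f hf _ h
      exact h (by rwa [f.injective this])
    · rw [hK f hf x hx]
  let φ : K →* Perm S :=
    { toFun := fun f => f.1.subtypePerm (hm f.1 f.2)
      map_one' := by ext x; simp
      map_mul' := by intro f g; ext x; rfl }
  have hφ : Function.Injective φ := by
    intro f g h
    ext x
    by_cases hx : x ∈ S
    · have := congrArg (fun t : Perm S => (t ⟨x, hx⟩ : α)) h
      simpa [φ] using this
    · rw [hK _ f.2 x hx, hK _ g.2 x hx]
  have := Subgroup.card_dvd_of_injective φ hφ
  rwa [Nat.card_perm, Nat.card_eq_fintype_card (α := S), Fintype.card_coe] at this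

section
variable {α : Type*} [Fintype α] [DecidableEq α] {G : Subgroup (Perm α)}

theorem norm_ext {p : ℕ} (hp : p.Prime) {g : Perm α} (hgc : g.IsCycle)
    (hgp : g.support.card = p) (hg : g ∈ G)
    (htr : IsMultiplyPretransitive G α (Fintype.card α - p)) {a b : α}
    (ha : a ∉ g.support) (hb : b ∉ g.support) :
    ∃ x ∈ G, x * g * x⁻¹ ∈ Subgroup.zpowers g ∧ ∀ z ∉ g.support, x z = swap a b z := by
  have := Fact.mk hp
  -- first an element of `G` acting as required
  have hcard : (g.supportᶜ).card = Fintype.card α - p := by rw [Finset.card_compl, hgp]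
  let e : Fin (Fintype.card α - p) ≃ (g.supportᶜ : Finset α) := (Finset.equivFinOfCardEq hcard).symm
  let u : Fin (Fintype.card α - p) ↪ α := e.toEmbedding.trans (Function.Embedding.subtype _)
  let v : Fin (Fintype.card α - p) ↪ α := u.trans (swap a b).toEmbedding
  obtain ⟨⟨h, hhG⟩, hh⟩ := isMultiplyPretransitive_iff.1 htr u v
  have hsw : ∀ z ∉ g.support, h z = swap a b z := by
    intro z hz
    have := DFunLike.congr_fun hh (e.symm ⟨z, by simpa using hz⟩)
    simpa [u, v, Subgroup.smul_def] using this
  have hsw' : ∀ z ∉ g.support, swap a b z ∉ g.support := by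
    intro z hz
    rw [swap_apply_def]; split_ifs <;> assumption
  have hinv : ∀ z ∉ g.support, h⁻¹ z ∉ g.support := by
    intro z hz
    have h1 : h (swap a b z) = z := by rw [hsw _ (hsw' z hz)]; simp
    have h2 : h⁻¹ z = swap a b z := by rw [Perm.inv_eq_iff_eq, h1]
    rw [h2]; exact hsw' z hz
  let K : Subgroup (Perm α) :=
    { carrier := {f | f ∈ G ∧ ∀ x ∉ g.support, f x = x}
      one_mem' := ⟨G.one_mem, fun _ _ => rfl⟩
      mul_mem' := fun {f f'} hf hf' => ⟨G.mul_mem hf.1 hf'.1, fun x hx => by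
        rw [Perm.mul_apply, hf'.2 x hx, hf.2 x hx]⟩
      inv_mem' := fun {f} hf => ⟨G.inv_mem hf.1, fun x hx => by
        rw [Perm.inv_eq_iff_eq, hf.2 x hx]⟩ }
  have hgK : g ∈ K := ⟨hg, fun x hx => by simpa using hx⟩
  have hg'K : h * g * h⁻¹ ∈ K := ⟨G.mul_mem (G.mul_mem hhG hg) (G.inv_mem hhG), fun x hx => by
    have : g (h⁻¹ x) = h⁻¹ x := by simpa using hinv x hx
    rw [Perm.mul_apply, Perm.mul_apply, this]; exact h.apply_symm_apply x⟩
  have hord : orderOf g = p := by rw [hgc.orderOf, hgp]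
  have hKc : Nat.card K ∣ p.factorial := hgp ▸ fix_card g.support K (fun f hf => hf.2)
  have hidx : ¬ p ∣ (Subgroup.zpowers (⟨g, hgK⟩ : K)).index := by
    intro hd
    have h1 := Subgroup.card_mul_index (Subgroup.zpowers (⟨g, hgK⟩ : K))
    rw [Nat.card_zpowers, Subgroup.orderOf_mk, hord] at h1
    have h2 : p * p ∣ p.factorial := (h1 ▸ Nat.mul_dvd_mul_left p hd : p * p ∣ Nat.card K).trans hKc
    rw [← Nat.mul_factorial_pred hp.ne_zero] at h2
    have h3 := Nat.dvd_of_mul_dvd_mul_left hp.pos h2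
    have := (hp.dvd_factorial).1 h3
    have := hp.pos
    omega
  have hPG : IsPGroup p (Subgroup.zpowers (⟨h * g * h⁻¹, hg'K⟩ : K)) := by
    apply IsPGroup.of_card (n := 1)
    rw [Nat.card_zpowers, Subgroup.orderOf_mk, pow_one, ← hord]
    exact orderOf_injective (MulAut.conj h).toMonoidHom (MulAut.conj h).injective g
  obtain ⟨⟨f, hfK⟩, hf⟩ := conj_into _ _ hPG hidx
  have hf1 := hf _ (Subgroup.mem_zpowers _)
  refine ⟨f⁻¹ * h, G.mul_mem (G.inv_mem hfK.1) hhG, ?_, ?_⟩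
  · obtain ⟨i, hi⟩ := hf1
    refine ⟨i, ?_⟩
    have := congrArg (fun t : K => (t : Perm α)) hi
    simp at this
    simp [this, mul_assoc]
  · intro z hz
    rw [Perm.mul_apply, hsw z hz, Perm.inv_eq_iff_eq, hfK.2 _ (hsw' z hz)]

theorem jordan_prime (hG : IsPreprimitive G α) {p : ℕ} (hp : p.Prime)
    (hp' : p + 3 ≤ Fintype.card α) {g : Perm α} (hgc : g.IsCycle) (hgp : g.support.card = p)
    (hg : g ∈ G) : alternatingGroup α ≤ G := by
  classical
  obtain ⟨m, hm⟩ := Nat.exists_eq_add_of_le hp'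
  have hp2 := hp.two_le
  have htr : IsMultiplyPreprimitive G α (m + 2 + 2) := by
    apply hG.isMultiplyPreprimitive (s := (g.supportᶜ : Set α))
    · apply Nat.add_left_cancel
      rw [Set.ncard_add_ncard_compl, Set.ncard_coe_finset, hgp, Nat.card_eq_fintype_card, hm]
      omega
    · rw [Nat.card_eq_fintype_card]; omega
    · have := isPretransitive_of_isCycle_mem hgc hg
      apply IsPreprimitive.of_prime_card
      convert! hp
      rw [Nat.card_eq_fintype_card, Fintype.card_subtype, ← hgp]
      apply congr_arg
      ext x
      simp [SubMulAction.mem_ofFixingSubgroup_iff]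
  have htr1 : IsMultiplyPretransitive G α (m + 2 + 2) :=
    IsMultiplyPreprimitive.isMultiplyPretransitive ..
  have htr2 : IsMultiplyPretransitive G α (Fintype.card α - p) :=
    isMultiplyPretransitive_of_le (n := m + 2 + 2) (by omega)
      (by rw [Nat.card_eq_fintype_card]; omega)
  have h3 : 2 < (g.supportᶜ).card := by rw [Finset.card_compl, hgp]; omega
  obtain ⟨a, b, c, ha, hb, hc, hab, hac, hbc⟩ := Finset.two_lt_card_iff.1 h3
  rw [Finset.mem_compl] at ha hb hc
  obtain ⟨x, hxG, ⟨i, hi⟩, hx⟩ := norm_ext hp hgc hgp hg htr2 ha hb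
  obtain ⟨y, hyG, ⟨j, hj⟩, hy⟩ := norm_ext hp hgc hgp hg htr2 ha hc
  simp only at hi hj
  have e1 : (x * y) * g * (x * y)⁻¹ = g ^ (i * j) := by
    calc (x * y) * g * (x * y)⁻¹ = x * (y * g * y⁻¹) * x⁻¹ := by group
      _ = x * g ^ j * x⁻¹ := by rw [hj]
      _ = (x * g * x⁻¹) ^ j := by rw [conj_zpow]
      _ = _ := by rw [← hi, zpow_mul]
  have e2 : (y * x) * g * (y * x)⁻¹ = g ^ (i * j) := by
    calc (y * x) * g * (y * x)⁻¹ = y * (x * g * x⁻¹) * y⁻¹ := by group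
      _ = y * g ^ i * y⁻¹ := by rw [hi]
      _ = (y * g * y⁻¹) ^ i := by rw [conj_zpow]
      _ = _ := by rw [← hj, mul_comm, zpow_mul]
  set w : Perm α := (y * x)⁻¹ * (x * y) with hw
  have hwG : w ∈ G := G.mul_mem (G.inv_mem (G.mul_mem hyG hxG)) (G.mul_mem hxG hyG)
  have hcomm : Commute w g := by
    have e3 := e1.trans e2.symm
    have e4 : w * g * w⁻¹ = g := by
      calc w * g * w⁻¹ = (y * x)⁻¹ * ((x * y) * g * (x * y)⁻¹) * (y * x) := by rw [hw]; group
        _ = g := by rw [e3]; group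
    exact mul_inv_eq_iff_eq_mul.1 e4
  obtain ⟨hc', ⟨k, hk⟩⟩ := hgc.commute_iff.1 hcomm
  have hsw1 : ∀ z ∉ g.support, swap a b z ∉ g.support := by
    intro z hz
    rw [swap_apply_def]; split_ifs <;> assumption
  have hsw2 : ∀ z ∉ g.support, swap a c z ∉ g.support := by
    intro z hz
    rw [swap_apply_def]; split_ifs <;> assumption
  have hss : ∀ s t z : α, swap s t (swap s t z) = z := by simp
  have key : w * (g ^ k)⁻¹ = (swap a b * swap a c) * (swap a b * swap a c) := by
    rw [mul_inv_eq_iff_eq_mul]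
    ext z
    by_cases hz : z ∈ g.support
    · have h1 : (g ^ k) z = w z := by
        simp only at hk
        rw [hk, ofSubtype_apply_of_mem _ hz]; rfl
      have h2 : w z ∈ g.support := (hc' z).2 hz
      rw [Perm.mul_apply _ (g ^ k), h1]
      have n1 : w z ≠ a := fun h => ha (h ▸ h2)
      have n2 : w z ≠ b := fun h => hb (h ▸ h2)
      have n3 : w z ≠ c := fun h => hc (h ▸ h2)
      simp only [Perm.mul_apply (swap _ _), Perm.mul_apply (_ * _) (swap a b * swap a c), swap_apply_of_ne_of_ne n1 n2, swap_apply_of_ne_of_ne n1 n3]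
    · have h1 : (g ^ k) z = z := by
        simp only at hk
        rw [hk, ofSubtype_apply_of_not_mem _ hz]
      rw [Perm.mul_apply _ (g ^ k), h1, hw, Perm.mul_apply, Perm.inv_eq_iff_eq]
      have q1 := hsw2 z hz
      have q2 := hsw1 _ q1
      have q3 := hsw2 _ q2
      have q4 := hsw1 _ q3
      simp only [Perm.mul_apply]
      rw [hy z hz, hx _ q1, hx _ q4, hss, hy _ q3, hss]
  refine alternatingGroup_le_of_isPreprimitive_of_isThreeCycle_mem hG
    (isThreeCycle_swap_mul_swap_same hab hac hbc).isThreeCycle_sq ?_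
  rw [← key]
  exact G.mul_mem hwG (G.inv_mem (G.zpow_mem hg k))
end

theorem four_swap {α : Type*} [DecidableEq α] (a b c d : α) :
    ({a, b, c, d} : Finset α) = {a, b, d, c} := by
  rw [Finset.pair_comm]

theorem four_dup1 {α : Type*} [DecidableEq α] (a b c : α) :
    ({a, b, c, a} : Finset α) = {a, b, c} := by
  ext; simp; tauto

theorem four_dup2 {α : Type*} [DecidableEq α] (a b c : α) :
    ({a, b, c, b} : Finset α) = {a, b, c} := by
  ext; simp; tauto

theorem split_two {α : Type*} [DecidableEq α] {T B : Finset α} {o : α} (hT : T.card = 4)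
    (hB : B.card = 4) (hTB : (T ∩ B).card = 2) (ho : o ∈ T) (ho' : o ∈ B) :
    ∃ a b c d e, T = {o, a, b, c} ∧ B = {o, a, d, e} ∧ [o, a, b, c, d, e].Nodup := by
  have hoI : o ∈ T ∩ B := Finset.mem_inter.2 ⟨ho, ho'⟩
  obtain ⟨a, ha⟩ := Finset.card_eq_one.1
    (show ((T ∩ B).erase o).card = 1 by rw [Finset.card_erase_of_mem hoI, hTB])
  have h1 : (T \ B).card = 2 := by
    have := Finset.card_sdiff_add_card_inter T B; omega
  have h2 : (B \ T).card = 2 := by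
    have := Finset.card_sdiff_add_card_inter B T; rw [Finset.inter_comm] at this; omega
  obtain ⟨b, c, hbc, hb⟩ := Finset.card_eq_two.1 h1
  obtain ⟨d, e, hde, hd⟩ := Finset.card_eq_two.1 h2
  have ea : ∀ x, (x ≠ o ∧ x ∈ T ∧ x ∈ B) ↔ x = a := by
    intro x; have := Finset.ext_iff.1 ha x; simpa using this
  have eb : ∀ x, (x ∈ T ∧ x ∉ B) ↔ x = b ∨ x = c := by
    intro x; have := Finset.ext_iff.1 hb x; simpa using this
  have ed : ∀ x, (x ∈ B ∧ x ∉ T) ↔ x = d ∨ x = e := by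
    intro x; have := Finset.ext_iff.1 hd x; simpa using this
  refine ⟨a, b, c, d, e, ?_, ?_, ?_⟩
  · ext x; have := ea x; have := eb x; have := ed x
    simp only [Finset.mem_insert, Finset.mem_singleton]; grind
  · ext x; have := ea x; have := eb x; have := ed x
    simp only [Finset.mem_insert, Finset.mem_singleton]; grind
  · have := (ea a).2 rfl
    have := (eb b).2 (Or.inl rfl)
    have := (eb c).2 (Or.inr rfl)
    have := (ed d).2 (Or.inl rfl)
    have := (ed e).2 (Or.inr rfl)
    simp only [List.nodup_cons, List.mem_cons, List.not_mem_nil, or_false, not_or]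
    grind

set_option maxHeartbeats 8000000 in
theorem comb {α : Type*} [Fintype α] [DecidableEq α] (h9 : 9 ≤ Fintype.card α)
    (F : Finset α → Prop) (o : α) (h4 : ∀ T, F T → T.card = 4)
    (hev : ∀ T B, F T → F B → T ≠ B → o ∈ T → o ∈ B → (T ∩ B).card = 2)
    (hcov : ∀ x, x ≠ o → ∃ T, F T ∧ o ∈ T ∧ x ∈ T)
    (hav : ∀ x, x ≠ o → ∃ T, F T ∧ o ∈ T ∧ x ∉ T) : False := by
  -- three triples through `o`
  obtain ⟨a, b, c, d, e, f, F1, F2, F3, nd⟩ : ∃ a b c d e f,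
      F {o, a, b, c} ∧ F {o, a, d, e} ∧ F {o, b, d, f} ∧ [o, a, b, c, d, e, f].Nodup := by
    obtain ⟨x, hx⟩ : ∃ x, x ≠ o := by
      have : Nontrivial α := Fintype.one_lt_card_iff_nontrivial.1 (by omega)
      exact exists_ne o
    obtain ⟨T, FT, oT, xT⟩ := hcov x hx
    obtain ⟨B, FB, oB, xB⟩ := hav x hx
    obtain ⟨a, b, c, d, e, rfl, rfl, nd⟩ := split_two (h4 T FT) (h4 B FB)
      (hev T B FT FB (fun h => xB (h ▸ xT)) oT oB) oT oB
    simp only [List.nodup_cons, List.mem_cons, List.not_mem_nil, or_false, not_or] at nd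
    obtain ⟨C, FC, oC, aC⟩ := hav a (by grind)
    obtain ⟨a1, b1, c1, d1, e1, k1, k2, nd1⟩ := split_two (h4 _ FT) (h4 C FC)
      (hev _ C FT FC (fun h => aC (h ▸ by simp)) oT oC) oT oC
    obtain ⟨a2, b2, c2, d2, e2, k3, k4, nd2⟩ := split_two (h4 _ FB) (h4 C FC)
      (hev _ C FB FC (fun h => aC (h ▸ by simp)) oB oC) oB oC
    have hc1 := Finset.ext_iff.1 k1
    have hc2 := Finset.ext_iff.1 k2
    have hc3 := Finset.ext_iff.1 k3
    have hc4 := Finset.ext_iff.1 k4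
    simp only [Finset.mem_insert, Finset.mem_singleton] at hc1 hc2 hc3 hc4
    simp only [List.nodup_cons, List.mem_cons, List.not_mem_nil, or_false, not_or] at nd1 nd2
    have e1' : a1 ∈ C := by rw [k2]; simp
    have e2' : a2 ∈ C := by rw [k4]; simp
    have m1 : a1 = b ∨ a1 = c := by have := (hc1 a1).2 (by simp); grind
    have m2 : a2 = d ∨ a2 = e := by have := (hc3 a2).2 (by simp); grind
    have hne : a1 ≠ a2 := by grind
    obtain ⟨f, hf⟩ : ∃ f, C = {o, a1, a2, f} := by
      have : a2 = d1 ∨ a2 = e1 := by have := (hc2 a2).1 e2'; grind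
      rcases this with h | h
      · exact ⟨e1, by rw [k2, h]⟩
      · exact ⟨d1, by rw [k2, h]; congr 2; exact Finset.pair_comm _ _⟩
    have hcC := h4 C FC
    have hff : f ≠ o ∧ f ≠ a1 ∧ f ≠ a2 := by
      refine ⟨?_, ?_, ?_⟩ <;> rintro rfl <;> rw [hf] at hcC
      · have := Finset.card_le_three (a := f) (b := a1) (c := a2)
        have h' : ({f, a1, a2, f} : Finset α) = {f, a1, a2} := four_dup1 _ _ _
        rw [h'] at hcC; omega
      · have := Finset.card_le_three (a := o) (b := f) (c := a2)
        have h' : ({o, f, a2, f} : Finset α) = {o, f, a2} := four_dup2 _ _ _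
        rw [h'] at hcC; omega
      · have := Finset.card_le_three (a := o) (b := a1) (c := f)
        have h' : ({o, a1, f, f} : Finset α) = {o, a1, f} := by ext; simp
        rw [h'] at hcC; omega
    have hfC : f ∈ C := by rw [hf]; simp
    have nfT : f ≠ a ∧ f ≠ b ∧ f ≠ c := by
      have := (hc1 f); have := (hc2 f); grind
    have nfB : f ≠ d ∧ f ≠ e := by
      have := (hc3 f); have := (hc4 f); grind
    rw [hf] at FC
    have sw1 : ({o, a, c, b} : Finset α) = {o, a, b, c} := four_swap _ _ _ _
    have sw2 : ({o, a, e, d} : Finset α) = {o, a, d, e} := four_swap _ _ _ _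
    rcases m1 with rfl | rfl <;> rcases m2 with rfl | rfl
    · exact ⟨a, _, c, _, e, f, FT, FB, FC, by simp; grind⟩
    · exact ⟨a, _, c, _, d, f, FT, by rwa [sw2], FC, by simp; grind⟩
    · exact ⟨a, _, b, _, e, f, by rwa [sw1], FB, FC, by simp; grind⟩
    · exact ⟨a, _, b, _, d, f, by rwa [sw1], by rwa [sw2], FC, by simp; grind⟩
  simp only [List.nodup_cons, List.mem_cons, List.not_mem_nil, or_false, not_or] at nd
  -- two more points
  let D : Finset α := {o, a, b, c, d, e, f}
  have hD : D.card ≤ 7 := (Finset.card_insert_le _ _).trans (Nat.succ_le_succ Finset.card_le_six)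
  have hDc : 1 < (Dᶜ).card := by rw [Finset.card_compl]; omega
  obtain ⟨x, hx, y, hy, hxy⟩ := Finset.one_lt_card.1 hDc
  have key : ∀ x ∈ Dᶜ, F {o, x, a, f} ∨ F {o, x, b, e} ∨ F {o, x, c, d} := by
    intro x hx
    simp only [D, Finset.mem_compl, Finset.mem_insert, Finset.mem_singleton, not_or] at hx
    obtain ⟨T, FT, oT, xT⟩ := hcov x (by grind)
    have inter : ∀ u v w, F {o, u, v, w} → x ≠ u → x ≠ v → x ≠ w →
        u ≠ v → u ≠ w → v ≠ w → o ≠ u → o ≠ v → o ≠ w →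
        (u ∈ T ∧ v ∉ T ∧ w ∉ T) ∨ (u ∉ T ∧ v ∈ T ∧ w ∉ T) ∨ (u ∉ T ∧ v ∉ T ∧ w ∈ T) := by
      intro u v w FB xu xv xw uv uw vw ou ov ow
      have h2 := hev _ T FB FT (by rintro rfl; simp at xT; grind) (by simp) oT
      by_cases hu : u ∈ T <;> by_cases hv : v ∈ T <;> by_cases hw : w ∈ T <;>
        simp_all [Finset.insert_inter_of_mem, Finset.insert_inter_of_notMem]
    have i1 := inter a b c F1 (by grind) (by grind) (by grind) (by grind) (by grind) (by grind)
      (by grind) (by grind) (by grind)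
    have i2 := inter a d e F2 (by grind) (by grind) (by grind) (by grind) (by grind) (by grind)
      (by grind) (by grind) (by grind)
    have i3 := inter b d f F3 (by grind) (by grind) (by grind) (by grind) (by grind) (by grind)
      (by grind) (by grind) (by grind)
    have four : ∀ u v, u ∈ T → v ∈ T → u ≠ v → u ≠ o → u ≠ x → v ≠ o → v ≠ x →
        T = {o, x, u, v} := by
      intro u v hu hv uv uo ux vo vx
      symm
      apply Finset.eq_of_subset_of_card_le
      · intro z; simp; grind
      · rw [h4 T FT, Finset.card_eq_of_equiv_fin (n := 4)]
        refine Fintype.equivFinOfCardEq ?_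
        rw [Fintype.card_coe]
        rw [Finset.card_insert_of_notMem, Finset.card_insert_of_notMem, Finset.card_pair uv] <;>
          simp <;> grind
    have not5 : ∀ u v w, u ∈ T → v ∈ T → w ∈ T → u ≠ v → u ≠ w → v ≠ w → u ≠ o → u ≠ x → v ≠ o →
        v ≠ x → w ≠ o → w ≠ x → False := by
      intro u v w hu hv hw uv uw vw uo ux vo vx wo wx
      have := four u v hu hv uv uo ux vo vx
      rw [this] at hw
      simp at hw; grind
    have n1 := not5 c e f
    by_cases ha : a ∈ T
    · left
      have hf : f ∈ T := by grind
      rwa [← four a f ha hf (by grind) (by grind) (by grind) (by grind) (by grind)]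
    · by_cases hb : b ∈ T
      · right; left
        have he : e ∈ T := by grind
        rwa [← four b e hb he (by grind) (by grind) (by grind) (by grind) (by grind)]
      · right; right
        have hc : c ∈ T := by grind
        have hd : d ∈ T := by grind
        rwa [← four c d hc hd (by grind) (by grind) (by grind) (by grind) (by grind)]
  have kx := key x hx
  have ky := key y hy
  simp only [D, Finset.mem_compl, Finset.mem_insert, Finset.mem_singleton, not_or] at hx hy
  have fin : ∀ u v w z, F {o, x, u, v} → F {o, y, w, z} → y ≠ u → y ≠ v →
      (u = w ∧ v = z) ∨ (u ≠ w ∧ u ≠ z ∧ v ≠ w ∧ v ≠ z) → x ≠ w → x ≠ z → o ≠ u → o ≠ v → o ≠ w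
      → o ≠ z → u ≠ v → False := by
    intro u v w z h1 h2 yu yv h xw xz ou ov ow oz uv
    have h3 := hev _ _ h1 h2 (fun he => by
      have : x ∈ ({o, y, w, z} : Finset α) := by rw [← he]; simp
      simp at this; grind) (by simp) (by simp)
    have hox : x ≠ o := by grind
    have hoy : y ≠ o := by grind
    rcases h with ⟨rfl, rfl⟩ | ⟨q1, q2, q3, q4⟩
    · have : ({o, x, u, v} ∩ {o, y, u, v} : Finset α) = {o, u, v} := by
        ext t; simp; grind
      rw [this, Finset.card_eq_three.2 ⟨o, u, v, ou, ov, uv, rfl⟩] at h3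
      omega
    · have : ({o, x, u, v} ∩ {o, y, w, z} : Finset α) = {o} := by
        ext t; simp; grind
      rw [this] at h3; simp at h3
  rcases kx with kx | kx | kx <;> rcases ky with ky | ky | ky <;>
    exact fin _ _ _ _ kx ky (by grind) (by grind) (by grind) (by grind) (by grind) (by grind)
      (by grind) (by grind) (by grind) (by grind)

theorem swap_comm_disj {α : Type*} [DecidableEq α] {p q r s : α} (h1 : p ≠ r) (h2 : p ≠ s)
    (h3 : q ≠ r) (h4 : q ≠ s) : swap p q * swap r s = swap r s * swap p q := by
  ext t
  simp only [Perm.mul_apply, swap_apply_def]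
  grind

theorem four_rot {α : Type*} [DecidableEq α] (a b c d : α) :
    ({b, c, d} ∪ {a} : Finset α) = {a, b, c, d} := by
  ext; simp; tauto

theorem four_rot' {α : Type*} [DecidableEq α] (a b c d : α) :
    ({d} ∪ {a, b, c} : Finset α) = {a, b, c, d} := by
  ext; simp; tauto

section two
variable {α : Type*} [Fintype α] [DecidableEq α] {G : Subgroup (Perm α)}

/-- `T` is a 4-set all of whose double transpositions are in `G`. -/
def DT (G : Subgroup (Perm α)) (T : Finset α) : Prop :=
  T.card = 4 ∧ ∀ a b c d, T = {a, b, c, d} → swap a b * swap c d ∈ G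

theorem DT.image {T : Finset α} (hT : DT G T) {h : Perm α} (hh : h ∈ G) : DT G (T.image h) := by
  refine ⟨by rw [Finset.card_image_of_injective _ h.injective, hT.1], ?_⟩
  intro a b c d he
  have h1 : T = {h⁻¹ a, h⁻¹ b, h⁻¹ c, h⁻¹ d} := by
    apply Finset.image_injective h.injective
    rw [he]
    simp
  have h2 := G.mul_mem (G.mul_mem hh (hT.2 _ _ _ _ h1)) (G.inv_mem hh)
  rw [swap_apply_apply, swap_apply_apply] at h2
  convert h2 using 1
  group

theorem DT.inter (hno : ∀ g ∈ G, ¬ IsThreeCycle g) {T B : Finset α} (hT : DT G T) (hB : DT G B)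
    (hne : T ≠ B) {o : α} (oT : o ∈ T) (oB : o ∈ B) : (T ∩ B).card = 2 := by
  have hpos : 0 < (T ∩ B).card := Finset.card_pos.2 ⟨o, Finset.mem_inter.2 ⟨oT, oB⟩⟩
  have hlt : (T ∩ B).card < 4 := by
    by_contra h
    have h1 := Finset.eq_of_subset_of_card_le (Finset.inter_subset_left (s₁ := T) (s₂ := B))
      (by rw [hT.1]; omega)
    have h2 := Finset.eq_of_subset_of_card_le (Finset.inter_subset_right (s₁ := T) (s₂ := B))
      (by rw [hB.1]; omega)
    exact hne (h1.symm.trans h2)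
  have hTd := Finset.card_sdiff_add_card_inter T B
  have hBd := Finset.card_sdiff_add_card_inter B T
  rw [Finset.inter_comm B T] at hBd
  rw [hT.1] at hTd
  rw [hB.1] at hBd
  have d1 := Finset.sdiff_union_inter T B
  have d2 := Finset.sdiff_union_inter B T
  rw [Finset.inter_comm B T] at d2
  by_contra h2
  have : (T ∩ B).card = 1 ∨ (T ∩ B).card = 3 := by omega
  rcases this with h | h
  · obtain ⟨x, hx⟩ := Finset.card_eq_one.1 h
    obtain ⟨b, c, d, bc, bd, cd, hb⟩ := Finset.card_eq_three.1 (show (T \ B).card = 3 by omega)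
    obtain ⟨e, f, i, ef, ei, fi, he⟩ := Finset.card_eq_three.1 (show (B \ T).card = 3 by omega)
    rw [hx, hb] at d1
    rw [hx, he] at d2
    have g1 := hT.2 x b c d (by rw [← d1, four_rot])
    have g2 := hB.2 x e f i (by rw [← d2, four_rot])
    have px : x ∈ T ∩ B := by rw [hx]; simp
    have pb : b ∈ T \ B := by rw [hb]; simp
    have pc : c ∈ T \ B := by rw [hb]; simp
    have pd : d ∈ T \ B := by rw [hb]; simp
    have pe : e ∈ B \ T := by rw [he]; simp
    have pf : f ∈ B \ T := by rw [he]; simp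
    have pi : i ∈ B \ T := by rw [he]; simp
    rw [Finset.mem_inter] at px
    rw [Finset.mem_sdiff] at pb pc pd pe pf pi
    have xb : x ≠ b := ne_of_mem_of_not_mem px.2 pb.2
    have xc : x ≠ c := ne_of_mem_of_not_mem px.2 pc.2
    have xd : x ≠ d := ne_of_mem_of_not_mem px.2 pd.2
    have xe : x ≠ e := ne_of_mem_of_not_mem px.1 pe.2
    have xf : x ≠ f := ne_of_mem_of_not_mem px.1 pf.2
    have xi : x ≠ i := ne_of_mem_of_not_mem px.1 pi.2
    have be : b ≠ e := ne_of_mem_of_not_mem pb.1 pe.2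
    have bf : b ≠ f := ne_of_mem_of_not_mem pb.1 pf.2
    have bi : b ≠ i := ne_of_mem_of_not_mem pb.1 pi.2
    have ce : c ≠ e := ne_of_mem_of_not_mem pc.1 pe.2
    have cf : c ≠ f := ne_of_mem_of_not_mem pc.1 pf.2
    have ci : c ≠ i := ne_of_mem_of_not_mem pc.1 pi.2
    have de : d ≠ e := ne_of_mem_of_not_mem pd.1 pe.2
    have df : d ≠ f := ne_of_mem_of_not_mem pd.1 pf.2
    have di : d ≠ i := ne_of_mem_of_not_mem pd.1 pi.2
    have key : (swap x b * swap c d) * (swap x e * swap f i) *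
        ((swap x b * swap c d) * (swap x e * swap f i)) =
        (swap x b * swap x e) * (swap x b * swap x e) := by
      have c1 := swap_comm_disj (p := c) (q := d) (r := x) (s := e) xc.symm ce xd.symm de
      have c2 := swap_comm_disj (p := c) (q := d) (r := f) (s := i) cf ci df di
      have c3 := swap_comm_disj (p := c) (q := d) (r := x) (s := b) xc.symm bc.symm xd.symm bd.symm
      have c4 := swap_comm_disj (p := f) (q := i) (r := x) (s := b) xf.symm bf.symm xi.symm bi.symm
      have c5 := swap_comm_disj (p := f) (q := i) (r := x) (s := e) xf.symm ef.symm xi.symm ei.symm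
      have hcd := swap_mul_self c d
      have hfi := swap_mul_self f i
      generalize swap x b = A at *
      generalize swap x e = B' at *
      generalize swap c d = C at *
      generalize swap f i = D at *
      calc A * C * (B' * D) * (A * C * (B' * D)) = A * (C * B') * D * A * (C * B') * D := by
            simp only [mul_assoc]
        _ = A * B' * C * (D * A) * B' * (C * D) := by rw [c1]; simp only [mul_assoc]
        _ = A * B' * (C * A) * (D * B') * D * C := by rw [c4, c2]; simp only [mul_assoc]
        _ = A * B' * A * (C * B') * (D * D) * C := by rw [c3, c5]; simp only [mul_assoc]
        _ = A * B' * A * B' * (C * C) := by rw [c1, hfi]; simp only [mul_assoc, one_mul]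
        _ = _ := by rw [hcd]; simp only [mul_assoc, mul_one]
    refine hno _ ?_ (isThreeCycle_swap_mul_swap_same xb xe be).isThreeCycle_sq
    rw [← key]
    exact G.mul_mem (G.mul_mem g1 g2) (G.mul_mem g1 g2)
  · obtain ⟨x, y, z, xy, xz, yz, hx⟩ := Finset.card_eq_three.1 h
    obtain ⟨w, hw⟩ := Finset.card_eq_one.1 (show (T \ B).card = 1 by omega)
    obtain ⟨v, hv⟩ := Finset.card_eq_one.1 (show (B \ T).card = 1 by omega)
    rw [hx, hw] at d1
    rw [hx, hv] at d2
    have g1 := hT.2 x y z w (by rw [← d1, four_rot'])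
    have g2 := hB.2 x y z v (by rw [← d2, four_rot'])
    have pz : z ∈ T ∩ B := by rw [hx]; simp
    have pw : w ∈ T \ B := by rw [hw]; simp
    have pv : v ∈ B \ T := by rw [hv]; simp
    simp only [Finset.mem_inter, Finset.mem_sdiff] at pz pw pv
    have zw : z ≠ w := ne_of_mem_of_not_mem pz.2 pw.2
    have zv : z ≠ v := ne_of_mem_of_not_mem pz.1 pv.2
    have wv : w ≠ v := ne_of_mem_of_not_mem pw.1 pv.2
    refine hno _ ?_ (isThreeCycle_swap_mul_swap_same zw zv wv)
    have := G.mul_mem (G.inv_mem g1) g2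
    simpa [mul_assoc] using this

theorem DT.two_trans (hG : IsPreprimitive G α) (h9 : 9 ≤ Fintype.card α) {T : Finset α}
    (hT : DT G T) : IsMultiplyPretransitive G α 2 := by
  obtain ⟨m, hm⟩ := Nat.exists_eq_add_of_le h9
  apply hG.is_two_pretransitive (s := (T : Set α)ᶜ) (n := m + 4)
  · apply Nat.add_left_cancel
    rw [Set.ncard_add_ncard_compl, Set.ncard_coe_finset, hT.1, Nat.card_eq_fintype_card, hm]
    omega
  · rw [Nat.card_eq_fintype_card]; omega
  rw [isPretransitive_iff]
  rintro ⟨x, hx⟩ ⟨y, hy⟩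
  have hx' : x ∈ T := by simpa [SubMulAction.mem_ofFixingSubgroup_iff] using hx
  have hy' : y ∈ T := by simpa [SubMulAction.mem_ofFixingSubgroup_iff] using hy
  suffices ∃ g ∈ G, (∀ z ∉ T, g z = z) ∧ g x = y by
    obtain ⟨g, hgG, hg, hxy⟩ := this
    refine ⟨⟨⟨g, hgG⟩, ?_⟩, ?_⟩
    · rw [mem_fixingSubgroup_iff]
      intro z hz
      exact hg z (by simpa using hz)
    · exact Subtype.ext hxy
  by_cases hxy : x = y
  · exact ⟨1, G.one_mem, fun _ _ => rfl, hxy⟩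
  have hc : ((T.erase x).erase y).card = 2 := by
    rw [Finset.card_erase_of_mem (by simp [hy', Ne.symm hxy]), Finset.card_erase_of_mem hx', hT.1]
  obtain ⟨c, d, cd, hcd⟩ := Finset.card_eq_two.1 hc
  have he : T = {x, y, c, d} := by
    rw [← hcd, Finset.insert_erase (by simp [hy', Ne.symm hxy]), Finset.insert_erase hx']
  have hcx : c ∈ (T.erase x).erase y := by rw [hcd]; simp
  have hdx : d ∈ (T.erase x).erase y := by rw [hcd]; simp
  simp only [Finset.mem_erase] at hcx hdx
  refine ⟨swap x y * swap c d, hT.2 _ _ _ _ he, ?_, ?_⟩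
  · intro z hz
    rw [he] at hz
    simp only [Finset.mem_insert, Finset.mem_singleton, not_or] at hz
    rw [Perm.mul_apply, swap_apply_of_ne_of_ne hz.2.2.1 hz.2.2.2,
      swap_apply_of_ne_of_ne hz.1 hz.2.1]
  · rw [Perm.mul_apply, swap_apply_of_ne_of_ne hcx.2.1.symm hdx.2.1.symm, swap_apply_left]

theorem jordan_two (hG : IsPreprimitive G α) (h9 : 9 ≤ Fintype.card α) {T : Finset α}
    (hT : DT G T) : alternatingGroup α ≤ G := by
  by_contra hcon
  have hno : ∀ g ∈ G, ¬ IsThreeCycle g := fun g hg h3 =>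
    hcon (alternatingGroup_le_of_isPreprimitive_of_isThreeCycle_mem hG h3 hg)
  have h2 : ∀ {a b c d : α} (_ : a ≠ b) (_ : c ≠ d), ∃ g : G, g • a = c ∧ g • b = d :=
    is_two_pretransitive_iff.1 (DT.two_trans hG h9 hT)
  obtain ⟨o, oT, q, qT, hoq⟩ := Finset.one_lt_card.1 (show 1 < T.card by rw [hT.1]; omega)
  refine comb h9 (DT G) o (fun T hT => hT.1) (fun T B hT hB hne oT oB => hT.inter hno hB hne oT oB)
    ?_ ?_
  · intro x hx
    obtain ⟨⟨g, hg⟩, h1, h3⟩ := h2 hoq hx.symm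
    exact ⟨T.image g, hT.image hg, Finset.mem_image.2 ⟨o, oT, h1⟩, Finset.mem_image.2 ⟨q, qT, h3⟩⟩
  · intro x hx
    obtain ⟨z, hz⟩ : ∃ z, z ∉ T := by
      by_contra h
      push Not at h
      have := hT.1
      rw [Finset.eq_univ_iff_forall.2 h, Finset.card_univ] at this
      omega
    obtain ⟨⟨g, hg⟩, h1, h3⟩ := h2 (show o ≠ z from fun h => hz (h ▸ oT)) hx.symm
    refine ⟨T.image g, hT.image hg, Finset.mem_image.2 ⟨o, oT, h1⟩, fun h => ?_⟩
    obtain ⟨t, ht, htx⟩ := Finset.mem_image.1 h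
    have : g t = g z := htx.trans h3.symm
    exact hz (g.injective this ▸ ht)
end two

/-- The Klein four group generated by two commuting involutions. -/
def klein {Γ : Type*} [Group Γ] (u v : Γ) (hu : u * u = 1) (hv : v * v = 1)
    (huv : u * v = v * u) : Subgroup Γ where
  carrier := {g | g = 1 ∨ g = u ∨ g = v ∨ g = u * v}
  one_mem' := Or.inl rfl
  mul_mem' := by
    have h1 : u * (u * v) = v := by rw [← mul_assoc, hu, one_mul]
    have h2 : v * (u * v) = u := by rw [huv, ← mul_assoc, hv, one_mul]
    have h3 : u * v * u = v := by rw [huv, mul_assoc, hu, mul_one]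
    have h4 : u * v * v = u := by rw [mul_assoc, hv, mul_one]
    have h5 : u * v * (u * v) = 1 := by rw [← mul_assoc, h3, hv]
    rintro a b (rfl | rfl | rfl | rfl) (rfl | rfl | rfl | rfl) <;>
      simp [h1, h2, h3, h4, h5, hu, hv, huv.symm]
  inv_mem' := by
    have h1 : u⁻¹ = u := inv_eq_of_mul_eq_one_left hu
    have h2 : v⁻¹ = v := inv_eq_of_mul_eq_one_left hv
    rintro a (rfl | rfl | rfl | rfl) <;> simp [h1, h2, huv.symm]

theorem klein_pgroup {Γ : Type*} [Group Γ] (u v : Γ) (hu : u * u = 1) (hv : v * v = 1)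
    (huv : u * v = v * u) : IsPGroup 2 (klein u v hu hv huv) := by
  rintro ⟨g, hg⟩
  refine ⟨1, Subtype.ext ?_⟩
  have h5 : u * v * (u * v) = 1 := by
    rw [huv, mul_assoc, ← mul_assoc u v, huv]; simp [mul_assoc, hv, hu]
  rcases hg with rfl | rfl | rfl | rfl <;> simp [pow_two, hu, hv, h5]

theorem exists_DT {n : ℕ} (hn : 9 ≤ n) (H : Subgroup (alternatingGroup (Fin n)))
    (h2 : ¬ 2 ∣ H.index) : ∃ T, DT (H.map (alternatingGroup (Fin n)).subtype) T := by
  have := Fact.mk Nat.prime_two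
  let a : Fin n := ⟨0, by omega⟩
  let b : Fin n := ⟨1, by omega⟩
  let c : Fin n := ⟨2, by omega⟩
  let d : Fin n := ⟨3, by omega⟩
  have ab : a ≠ b := by simp [a, b]
  have ac : a ≠ c := by simp [a, c]
  have ad : a ≠ d := by simp [a, d]
  have bc : b ≠ c := by simp [b, c]
  have bd : b ≠ d := by simp [b, d]
  have cd : c ≠ d := by simp [c, d]
  clear_value a b c d
  have mem : ∀ x y z w : Fin n, x ≠ y → z ≠ w → swap x y * swap z w ∈ alternatingGroup (Fin n) := by
    intro x y z w h1 h2
    rw [mem_alternatingGroup, map_mul, sign_swap h1, sign_swap h2]; rfl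
  let u : alternatingGroup (Fin n) := ⟨swap a b * swap c d, mem _ _ _ _ ab cd⟩
  let v : alternatingGroup (Fin n) := ⟨swap a c * swap b d, mem _ _ _ _ ac bd⟩
  have hu : u * u = 1 := by
    apply Subtype.ext; ext t : 1
    simp only [u, Subgroup.coe_mul, Subgroup.coe_one, Perm.mul_apply, swap_apply_def, Perm.one_apply]; grind
  have hv : v * v = 1 := by
    apply Subtype.ext; ext t : 1
    simp only [v, Subgroup.coe_mul, Subgroup.coe_one, Perm.mul_apply, swap_apply_def, Perm.one_apply]; grind
  have huv : u * v = v * u := by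
    apply Subtype.ext; ext t : 1
    simp only [u, v, Subgroup.coe_mul, Perm.mul_apply, swap_apply_def]; grind
  have huv' : (u * v).1 = swap a d * swap b c := by
    ext t : 1
    simp only [u, v, Subgroup.coe_mul, Perm.mul_apply, swap_apply_def]; grind
  obtain ⟨x, hx⟩ := conj_into _ _ (klein_pgroup u v hu hv huv) h2
  have k1 := hx u (Or.inr (Or.inl rfl))
  have k2 := hx v (Or.inr (Or.inr (Or.inl rfl)))
  have k3 := hx (u * v) (Or.inr (Or.inr (Or.inr rfl)))
  let h : Perm (Fin n) := x.1⁻¹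
  set G := H.map (alternatingGroup (Fin n)).subtype with hGdef
  have conv : ∀ p q r s : Fin n, ∀ k : alternatingGroup (Fin n), x⁻¹ * k * x ∈ H →
      k.1 = swap p q * swap r s → swap (h p) (h q) * swap (h r) (h s) ∈ G := by
    intro p q r s k hk hk'
    refine ⟨_, hk, ?_⟩
    rw [swap_apply_apply, swap_apply_apply]
    simp [hk', h, mul_assoc]
  have m1 := conv a b c d u k1 rfl
  have m2 := conv a c b d v k2 rfl
  have m3 := conv a d b c (u * v) k3 huv'
  have ab' := h.injective.ne ab
  have ac' := h.injective.ne ac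
  have ad' := h.injective.ne ad
  have bc' := h.injective.ne bc
  have bd' := h.injective.ne bd
  have cd' := h.injective.ne cd
  generalize h a = A at *
  generalize h b = B at *
  generalize h c = C at *
  generalize h d = D at *
  clear_value G
  have sw : ∀ {p q r s : Fin n}, p ≠ r → p ≠ s → q ≠ r → q ≠ s →
      swap p q * swap r s ∈ G → swap r s * swap p q ∈ G := by
    intro p q r s h1 h2 h3 h4 hh
    convert hh using 1
    ext t : 1
    simp only [Perm.mul_apply, swap_apply_def]
    grind
  have m1' := sw ac' ad' bc' bd' m1
  have m2' := sw ab' ad' bc'.symm cd' m2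
  have m3' := sw ab' ac' bd'.symm cd'.symm m3
  refine ⟨{A, B, C, D}, ?_, ?_⟩
  · rw [Finset.card_insert_of_notMem, Finset.card_insert_of_notMem, Finset.card_pair cd'] <;>
      simp [*]
  · intro p q r s he
    have hc : ({p, q, r, s} : Finset (Fin n)).card = 4 := by
      rw [← he, Finset.card_insert_of_notMem, Finset.card_insert_of_notMem, Finset.card_pair cd'] <;>
        simp [*]
    have hnd : [p, q, r, s].Nodup := by
      have := (Multiset.toFinset_card_eq_card_iff_nodup (m := ([p, q, r, s] : Multiset (Fin n)))).1
        (by simpa using hc)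
      simpa using this
    simp only [List.nodup_cons, List.mem_cons, List.not_mem_nil, or_false, not_or] at hnd
    obtain ⟨⟨pq, pr, ps⟩, ⟨qr, qs⟩, rs, -⟩ := hnd
    have f1 : ∀ {p q r s : Fin n}, swap q p * swap r s ∈ G → swap p q * swap r s ∈ G := by
      intro p q r s h; rwa [swap_comm p q]
    have f2 : ∀ {p q r s : Fin n}, swap p q * swap s r ∈ G → swap p q * swap r s ∈ G := by
      intro p q r s h; rwa [swap_comm r s]
    have hm : ∀ t ∈ ({p, q, r, s} : Finset (Fin n)), t = A ∨ t = B ∨ t = C ∨ t = D := by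
      intro t ht; rw [← he] at ht; simpa using ht
    have hp := hm p (by simp)
    have hq := hm q (by simp)
    have hr := hm r (by simp)
    have hs := hm s (by simp)
    clear hm he hc k1 k2 k3 conv sw hx
    have comb4 : ∀ {p q : Fin n}, p ≠ q → (p = A ∨ p = B ∨ p = C ∨ p = D) →
        (q = A ∨ q = B ∨ q = C ∨ q = D) → r ≠ s → p ≠ r → p ≠ s → q ≠ r → q ≠ s →
        swap p q * swap r s ∈ G := by
      intro p q pq hp hq rs pr ps qr qs
      rcases hp with rfl | rfl | rfl | rfl <;> rcases hq with rfl | rfl | rfl | rfl <;>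
        try exact absurd rfl pq
      all_goals
        rcases hr with rfl | rfl | rfl | rfl <;>
          first
          | exact absurd rfl pr
          | exact absurd rfl qr
          | skip
      all_goals
        rcases hs with rfl | rfl | rfl | rfl <;>
          first
          | exact absurd rfl ps
          | exact absurd rfl qs
          | exact absurd rfl rs
          | assumption
          | exact f1 (by assumption)
          | exact f2 (by assumption)
          | exact f1 (f2 (by assumption))
    exact comb4 pq hp hq rs pr ps qr qs

theorem main_aux (n p : ℕ) (hn : 9 ≤ n) (hp : p.Prime) (hpn : p ≤ n - 3)
    (H : Subgroup (alternatingGroup (Fin n))) (hH : H ≠ ⊤)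
    (htrans : MulAction.IsPretransitive H (Fin n))
    (hprim : ∀ B : Set (Fin n), MulAction.IsBlock H B → MulAction.IsTrivialBlock B) :
    p ∣ H.index := by
  by_contra hdvd
  have := Fact.mk hp
  set G := H.map (alternatingGroup (Fin n)).subtype with hGdef
  have hHG : ∀ x : alternatingGroup (Fin n), x ∈ H → x.1 ∈ G := fun x hx => ⟨x, hx, rfl⟩
  have hG : IsPreprimitive G (Fin n) :=
    { exists_smul_eq := fun x y => by
        obtain ⟨g, hg⟩ := htrans.exists_smul_eq x y
        exact ⟨⟨g.1.1, hHG _ g.2⟩, hg⟩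
      isTrivialBlock_of_isBlock := fun {B} hB => by
        refine hprim B ?_
        intro g₁ g₂ hne
        exact hB (g₁ := ⟨g₁.1.1, hHG _ g₁.2⟩) (g₂ := ⟨g₂.1.1, hHG _ g₂.2⟩) hne }
  suffices hle : alternatingGroup (Fin n) ≤ G by
    apply hH
    rw [eq_top_iff]
    intro x _
    obtain ⟨y, hy, hyx⟩ := hle x.2
    have : y = x := Subtype.ext hyx
    exact this ▸ hy
  rcases hp.eq_two_or_odd with rfl | hodd
  · obtain ⟨T, hT⟩ := exists_DT hn H hdvd
    exact jordan_two hG (by simpa using hn) hT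
  · have hp2 := hp.two_le
    obtain ⟨g, hg⟩ := (Perm.exists_with_cycleType_iff (α := Fin n) (m := {p})).2
      ⟨by simp; omega, by simpa using hp2⟩
    have hgc : g.IsCycle := by rw [← card_cycleType_eq_one, hg]; simp
    have hgs : g.support.card = p := by rw [← sum_cycleType, hg]; simp
    have hga : g ∈ alternatingGroup (Fin n) := by
      rw [mem_alternatingGroup, hgc.sign, hgs, Odd.neg_one_pow (Nat.odd_iff.2 hodd)]; rfl
    have hPG : IsPGroup p (Subgroup.zpowers (⟨g, hga⟩ : alternatingGroup (Fin n))) := by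
      apply IsPGroup.of_card (n := 1)
      rw [Nat.card_zpowers, Subgroup.orderOf_mk, pow_one, hgc.orderOf, hgs]
    obtain ⟨x, hx⟩ := conj_into _ _ hPG hdvd
    have h1 := hHG _ (hx _ (Subgroup.mem_zpowers _))
    have h2 : x.1⁻¹ * g * (x.1⁻¹)⁻¹ ∈ G := by simpa using h1
    refine jordan_prime hG hp (by simp; omega) (hgc.conj (g := x.1⁻¹)) ?_ h2
    rw [card_support_conj, hgs]

end aux


theorem stmt_15 (n p : ℕ) (hn : 9 ≤ n) (hp : p.Prime) (hpn : p ≤ n - 3)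
    (H : Subgroup (alternatingGroup (Fin n))) (hH : H ≠ ⊤)
    (htrans : MulAction.IsPretransitive H (Fin n))
    (hprim : ∀ B : Set (Fin n), MulAction.IsBlock H B → MulAction.IsTrivialBlock B) :
    p ∣ H.index :=
  main_aux n p hn hp hpn H hH htrans hprim
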